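/- Under the same model as Observation 3 — A a finite set with at least 3 elements, O ⊆ A with 2 ≤ |O| < |A|, real numbers 0 < p_A < 1 and 0 < p_B ≤ 1, and mutually independent events (E_{uv}) over unordered pairs of distinct elements of A with P(E_{uv}) = 1 − (1−p_A)(1−p_B) when u,v ∈ O and P(E_{uv}) = p_A otherwise, and internal degree d(u) = #{v ≠ u : E_{uv} occurs} — for any fixed o ∈ O, the probability P(d(o) = max_{u∈A} d(u)) is strictly greater than 1/|A|. -/

import Mathlib

open MeasureTheory ProbabilityTheory

/-- The probability of the configuration `x` when the coordinates are independent and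
coordinate `i` is `true` with probability `r i`. -/
noncomputable def bernoulliWeight {ι : Type*} [Fintype ι] (r : ι → ℝ) (x : ι → Bool) : ℝ :=
  ∏ i, if x i then r i else 1 - r i

section Weight

lemma comp_swap_eq_self {ι : Type*} [DecidableEq ι] {x : ι → Bool} {a b : ι} (h : x a = x b) :
    x ∘ Equiv.swap a b = x := by
  ext i
  simp only [Function.comp_apply, Equiv.swap_apply_def]
  split_ifs with h₁ h₂
  · rw [h₁, h]
  · rw [h₂, h]
  · rfl

variable {ι : Type*} [Fintype ι] {r : ι → ℝ}

lemma bernoulliWeight_nonneg (hr0 : ∀ i, 0 ≤ r i) (hr1 : ∀ i, r i ≤ 1) (x : ι → Bool) :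
    0 ≤ bernoulliWeight r x := by
  refine Finset.prod_nonneg fun i _ => ?_
  split_ifs
  · exact hr0 i
  · linarith [hr1 i]

lemma bernoulliWeight_comp_equiv (r : ι → ℝ) (x : ι → Bool) (σ : ι ≃ ι) :
    bernoulliWeight (r ∘ σ) (x ∘ σ) = bernoulliWeight r x :=
  Equiv.prod_comp σ fun i => if x i then r i else 1 - r i

lemma sum_bernoulliWeight_comp_equiv [DecidableEq ι] (f : (ι → Bool) → ℝ) (r : ι → ℝ)
    (σ : ι ≃ ι) :
    ∑ x, f x * bernoulliWeight (r ∘ σ) x = ∑ x, f (x ∘ σ) * bernoulliWeight r x := by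
  rw [← Equiv.sum_comp (σ.symm.arrowCongr (Equiv.refl Bool))]
  refine Finset.sum_congr rfl fun x _ => ?_
  have h : (σ.symm.arrowCongr (Equiv.refl Bool)) x = x ∘ σ := by
    ext i; simp [Equiv.arrowCongr]
  rw [h, bernoulliWeight_comp_equiv]

lemma bernoulliWeight_swap_le [DecidableEq ι] (hr0 : ∀ i, 0 ≤ r i) (hr1 : ∀ i, r i ≤ 1)
    {a b : ι} (hab : a ≠ b) (hle : r b ≤ r a) {x : ι → Bool} (hxa : x a = true)
    (hxb : x b = false) :
    bernoulliWeight r (x ∘ Equiv.swap a b) ≤ bernoulliWeight r x := by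
  have hb : b ∈ Finset.univ.erase a := by simp [hab.symm]
  unfold bernoulliWeight
  rw [← Finset.mul_prod_erase _ _ (Finset.mem_univ a), ← Finset.mul_prod_erase _ _ hb,
    ← Finset.mul_prod_erase Finset.univ (fun i => if x i then r i else 1 - r i)
      (Finset.mem_univ a),
    ← Finset.mul_prod_erase _ (fun i => if x i then r i else 1 - r i) hb]
  have hrest : ∏ i ∈ (Finset.univ.erase a).erase b,
        (if (x ∘ Equiv.swap a b) i then r i else 1 - r i)
      = ∏ i ∈ (Finset.univ.erase a).erase b, if x i then r i else 1 - r i := by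
    refine Finset.prod_congr rfl fun i hi => ?_
    simp only [Finset.mem_erase, Finset.mem_univ, and_true] at hi
    simp [Equiv.swap_apply_of_ne_of_ne hi.2 hi.1]
  have hnn : 0 ≤ ∏ i ∈ (Finset.univ.erase a).erase b, if x i then r i else 1 - r i := by
    refine Finset.prod_nonneg fun i _ => ?_
    split_ifs
    · exact hr0 i
    · linarith [hr1 i]
  rw [hrest, ← mul_assoc, ← mul_assoc]
  refine mul_le_mul_of_nonneg_right ?_ hnn
  simp only [Function.comp_apply, Equiv.swap_apply_left, Equiv.swap_apply_right, hxa, hxb,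
    if_true, Bool.false_eq_true, if_false]
  nlinarith [hle]

lemma sum_bernoulliWeight [DecidableEq ι] (r : ι → ℝ) :
    ∑ x : ι → Bool, bernoulliWeight r x = 1 := by
  simp only [bernoulliWeight]
  rw [← Fintype.prod_sum fun i (b : Bool) => if b then r i else 1 - r i]
  simp

/-- Exchanging two parameters so that the larger one is at `b` lowers the expectation of a
function that prefers `a` to `b`. -/
lemma sum_bernoulliWeight_swap_le [DecidableEq ι] (hr0 : ∀ i, 0 ≤ r i) (hr1 : ∀ i, r i ≤ 1)
    {a b : ι} (hab : a ≠ b) (hle : r b ≤ r a) {f : (ι → Bool) → ℝ}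
    (hf : ∀ x : ι → Bool, x a = true → x b = false → f (x ∘ Equiv.swap a b) ≤ f x) :
    ∑ x, f x * bernoulliWeight (r ∘ Equiv.swap a b) x ≤ ∑ x, f x * bernoulliWeight r x := by
  set τ := Equiv.swap a b with hτ
  have hττ : ∀ x : ι → Bool, (x ∘ τ) ∘ τ = x := fun x => by ext i; simp [hτ]
  have hW : ∀ x, bernoulliWeight (r ∘ τ) x = bernoulliWeight r (x ∘ τ) := fun x => by
    rw [← bernoulliWeight_comp_equiv r (x ∘ τ) τ, hττ]
  have key : ∀ x, 0 ≤ (f x - f (x ∘ τ)) * (bernoulliWeight r x - bernoulliWeight r (x ∘ τ)) := by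
    intro x
    cases ha : x a <;> cases hb : x b
    · rw [comp_swap_eq_self (ha.trans hb.symm)]; simp
    · have h₁ : (x ∘ τ) a = true := by simp [hτ, hb]
      have h₂ : (x ∘ τ) b = false := by simp [hτ, ha]
      have h₃ := hf _ h₁ h₂
      have h₄ := bernoulliWeight_swap_le hr0 hr1 hab hle h₁ h₂
      rw [hττ] at h₃ h₄
      exact mul_nonneg_of_nonpos_of_nonpos (by linarith) (by linarith)
    · exact mul_nonneg (sub_nonneg.2 (hf x ha hb))
        (sub_nonneg.2 (bernoulliWeight_swap_le hr0 hr1 hab hle ha hb))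
    · rw [comp_swap_eq_self (ha.trans hb.symm)]; simp
  have hsum := Finset.sum_nonneg fun x (_ : x ∈ Finset.univ) => key x
  have h₁ := sum_bernoulliWeight_comp_equiv f r τ
  have h₂ := sum_bernoulliWeight_comp_equiv (fun x => f (x ∘ τ)) r τ
  simp only [hττ, hW] at h₁ h₂
  simp only [hW]
  simp only [sub_mul, mul_sub, Finset.sum_sub_distrib] at hsum
  linarith

/-- Iterated form of `sum_bernoulliWeight_swap_le`, for the disjoint pairs `(a w, b w)`. -/
lemma sum_bernoulliWeight_le_of_exchange [DecidableEq ι] {κ : Type*} [DecidableEq κ]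
    {a b : κ → ι} (ha : Function.Injective a) (hb : Function.Injective b) (T : Finset κ)
    (hab : ∀ i ∈ T, ∀ j ∈ T, a i ≠ b j) {f : (ι → Bool) → ℝ}
    (hf : ∀ w ∈ T, ∀ x : ι → Bool, x (a w) = true → x (b w) = false →
      f (x ∘ Equiv.swap (a w) (b w)) ≤ f x)
    {r r' : ι → ℝ} (hr0 : ∀ i, 0 ≤ r i) (hr1 : ∀ i, r i ≤ 1)
    (hle : ∀ w ∈ T, r (b w) ≤ r (a w)) (hra : ∀ w ∈ T, r' (a w) = r (b w))
    (hrb : ∀ w ∈ T, r' (b w) = r (a w))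
    (hrest : ∀ i, (∀ w ∈ T, i ≠ a w ∧ i ≠ b w) → r' i = r i) :
    ∑ x, f x * bernoulliWeight r' x ≤ ∑ x, f x * bernoulliWeight r x := by
  induction T using Finset.induction_on generalizing r with
  | empty =>
    have : r' = r := funext fun i => hrest i (by simp)
    rw [this]
  | insert w T hw ih =>
    have hwT := Finset.mem_insert_self w T
    have hT : ∀ {j}, j ∈ T → j ∈ insert w T := Finset.mem_insert_of_mem
    have hfix : ∀ i, i ≠ a w → i ≠ b w → (r ∘ Equiv.swap (a w) (b w)) i = r i := fun i h₁ h₂ => by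
      simp [Equiv.swap_apply_of_ne_of_ne h₁ h₂]
    have hne : ∀ {j}, j ∈ T → j ≠ w := fun hj h => hw (h ▸ hj)
    have hfa : ∀ j ∈ T, (r ∘ Equiv.swap (a w) (b w)) (a j) = r (a j) := fun j hj =>
      hfix _ (ha.ne (hne hj)) (hab j (hT hj) w hwT)
    have hfb : ∀ j ∈ T, (r ∘ Equiv.swap (a w) (b w)) (b j) = r (b j) := fun j hj =>
      hfix _ (hab w hwT j (hT hj)).symm (hb.ne (hne hj))
    refine le_trans (ih (r := r ∘ Equiv.swap (a w) (b w))
      (fun i hi j hj => hab i (hT hi) j (hT hj)) (fun i hi => hf i (hT hi))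
      (fun i => hr0 _) (fun i => hr1 _) ?_ ?_ ?_ ?_)
      (sum_bernoulliWeight_swap_le hr0 hr1 (hab w hwT w hwT) (hle w hwT) (hf w hwT))
    · intro j hj; rw [hfa j hj, hfb j hj]; exact hle j (hT hj)
    · intro j hj; rw [hfb j hj]; exact hra j (hT hj)
    · intro j hj; rw [hfa j hj]; exact hrb j (hT hj)
    · intro i hi
      by_cases h₁ : i = a w
      · subst h₁; simpa using hra w hwT
      by_cases h₂ : i = b w
      · subst h₂; simpa using hrb w hwT
      rw [hfix i h₁ h₂]
      exact hrest i fun j hj => (Finset.mem_insert.1 hj).elim (fun h => h ▸ ⟨h₁, h₂⟩) (hi j)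

end Weight

section Degree

variable {V : Type*} [DecidableEq V] {A : Finset V}

/-- The degree of `u` inside `A` in the graph whose edges are the pairs where `x` is `true`. -/
def internalDegree (A : Finset V) (x : Sym2 V → Bool) (u : V) : ℕ :=
  (A.filter fun t => t ≠ u ∧ x s(u, t) = true).card

/-- `u` has the largest internal degree in `A`. -/
def IsConnector (A : Finset V) (x : Sym2 V → Bool) (u : V) : Prop :=
  ∀ t ∈ A, internalDegree A x t ≤ internalDegree A x u

lemma swap_mem_iff {o v : V} (ho : o ∈ A) (hv : v ∈ A) (t : V) :
    Equiv.swap o v t ∈ A ↔ t ∈ A := by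
  rw [Equiv.swap_apply_def]
  split_ifs with h₁ h₂ <;> simp_all

lemma internalDegree_comp_map (π : Equiv.Perm V) (hπ : ∀ t, π t ∈ A ↔ t ∈ A)
    (x : Sym2 V → Bool) (u : V) :
    internalDegree A (x ∘ Sym2.map π) u = internalDegree A x (π u) := by
  refine Finset.card_equiv π fun t => ?_
  rw [Finset.mem_filter, Finset.mem_filter]
  simp [hπ]

lemma isConnector_comp_map (π : Equiv.Perm V) (hπ : ∀ t, π t ∈ A ↔ t ∈ A)
    (x : Sym2 V → Bool) (u : V) :
    IsConnector A (x ∘ Sym2.map π) u ↔ IsConnector A x (π u) := by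
  simp only [IsConnector, internalDegree_comp_map π hπ]
  refine ⟨fun h t ht => ?_, fun h t ht => h _ ((hπ t).2 ht)⟩
  have := h (π.symm t) ((hπ _).1 (by simpa using ht))
  simpa using this

/-- Moving an edge at `v` over to `o` keeps `o` a connector. -/
lemma IsConnector.of_swap {o v w : V} (ho : o ∈ A) (hv : v ∈ A) (hwo : w ≠ o)
    (hwv : w ≠ v) {x : Sym2 V → Bool} (hxo : x s(o, w) = true) (hxv : x s(v, w) = false)
    (h : IsConnector A (x ∘ Equiv.swap s(o, w) s(v, w)) o) : IsConnector A x o := by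
  by_cases hov : o = v
  · subst hov; simp_all
  set x' := x ∘ Equiv.swap s(o, w) s(v, w) with hx'
  have hx'o : x' s(o, w) = false := by simp [hx', hxv]
  have hx'v : x' s(v, w) = true := by simp [hx', hxo]
  have hfix : ∀ s, s ≠ s(o, w) → s ≠ s(v, w) → x' s = x s := fun s h₁ h₂ => by
    simp [hx', Equiv.swap_apply_of_ne_of_ne h₁ h₂]
  have hdo : internalDegree A x' o ≤ internalDegree A x o := by
    refine Finset.card_le_card fun t => ?_
    simp only [Finset.mem_filter]
    rintro ⟨h₁, h₂, h₃⟩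
    refine ⟨h₁, h₂, ?_⟩
    by_cases htw : t = w
    · rw [htw]; exact hxo
    · rwa [hfix] at h₃
      · simp; grind
      · simp; grind
  have hdv : internalDegree A x v ≤ internalDegree A x' v := by
    refine Finset.card_le_card fun t => ?_
    simp only [Finset.mem_filter]
    rintro ⟨h₁, h₂, h₃⟩
    refine ⟨h₁, h₂, ?_⟩
    by_cases htw : t = w
    · rw [htw]; exact hx'v
    · rwa [hfix]
      · simp; grind
      · simp; grind
  have hdw : internalDegree A x w = internalDegree A x' w := by
    refine Finset.card_equiv (Equiv.swap o v) fun t => ?_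
    simp only [Finset.mem_filter, swap_mem_iff ho hv]
    by_cases hto : t = o
    · subst hto
      rw [Equiv.swap_apply_left, Sym2.eq_swap, hxo, Sym2.eq_swap, hx'v]
      simp [hwo.symm, hwv.symm]
    by_cases htv : t = v
    · subst htv
      rw [Equiv.swap_apply_right, Sym2.eq_swap, hxv, Sym2.eq_swap, hx'o]
      simp
    rw [Equiv.swap_apply_of_ne_of_ne hto htv, hfix]
    · simp; grind
    · simp; grind
  intro u hu
  by_cases huo : u = o
  · rw [huo]
  refine le_trans ?_ ((h u hu).trans hdo)
  by_cases huv : u = v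
  · rw [huv]; exact hdv
  by_cases huw : u = w
  · rw [huw]; exact hdw.le
  refine Finset.card_le_card fun t => ?_
  simp only [Finset.mem_filter]
  rintro ⟨h₁, h₂, h₃⟩
  refine ⟨h₁, h₂, ?_⟩
  rwa [hfix]
  · simp; grind
  · simp; grind

end Degree

section Configuration

open Classical in
/-- The indicator configuration of a family of events. -/
noncomputable def eventConfig {Ω ι : Type*} (E : ι → Set Ω) (ω : Ω) : ι → Bool :=
  fun i => decide (ω ∈ E i)

lemma setOf_eventConfig_eq {Ω ι : Type*} (E : ι → Set Ω) (x : ι → Bool) :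
    {ω | eventConfig E ω = x} = ⋂ i, if x i then E i else (E i)ᶜ := by
  ext ω
  simp only [Set.mem_ofPred_eq, funext_iff, Set.mem_iInter, eventConfig]
  refine forall_congr' fun i => ?_
  cases x i <;> simp

variable {Ω ι : Type*} [MeasurableSpace Ω] {μ : Measure Ω} {E : ι → Set Ω}

/-- Restricting a family to a set of indices by emptying the other events keeps independence. -/
lemma iIndepSet_ite_empty {p : ι → Prop} [DecidablePred p]
    (hE : ∀ i, MeasurableSet (E i)) (h : iIndepSet (fun i : {i // p i} => E i.1) μ) :
    iIndepSet (fun i => if p i then E i else ∅) μ := by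
  rw [iIndepSet_iff_meas_biInter fun i : {i // p i} => hE i.1] at h
  rw [iIndepSet_iff_meas_biInter fun i => by split_ifs; exacts [hE i, MeasurableSet.empty]]
  intro S
  by_cases hS : ∀ i ∈ S, p i
  · have hprod := h (S.subtype p)
    rw [Finset.prod_subtype_of_mem (fun i => μ (E i)) hS] at hprod
    rw [Finset.prod_congr rfl fun i hi => by rw [if_pos (hS i hi)], ← hprod]
    congr 1
    ext ω
    simp only [Set.mem_iInter, Finset.mem_subtype, Subtype.forall]
    refine forall_congr' fun i => ⟨fun h₁ hp hi => ?_, fun h₁ hi => ?_⟩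
    · simpa [hp] using h₁ hi
    · simpa [hS i hi] using h₁ (hS i hi) hi
  · push Not at hS
    obtain ⟨i, hi, hpi⟩ := hS
    rw [Finset.prod_eq_zero hi (by simp [hpi])]
    refine measure_mono_null (Set.biInter_subset_of_mem hi) (by simp [hpi])

lemma measurableSet_eventConfig_eq [Countable ι] (hE : ∀ i, MeasurableSet (E i))
    (x : ι → Bool) : MeasurableSet {ω | eventConfig E ω = x} := by
  rw [setOf_eventConfig_eq]
  refine MeasurableSet.iInter fun i => ?_
  split_ifs
  exacts [hE i, (hE i).compl]

lemma measureReal_eventConfig_eq [Fintype ι] [IsProbabilityMeasure μ]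
    (hE : ∀ i, MeasurableSet (E i)) (h : iIndepSet E μ) (x : ι → Bool) :
    μ.real {ω | eventConfig E ω = x} = bernoulliWeight (fun i => μ.real (E i)) x := by
  rw [setOf_eventConfig_eq, measureReal_def,
    ((iIndepSet_iff_iIndep _ _).1 h).meas_iInter fun i => ?_,
    ENNReal.toReal_prod, bernoulliWeight]
  · refine Finset.prod_congr rfl fun i _ => ?_
    split_ifs
    · rfl
    · exact probReal_compl_eq_one_sub (hE i)
  · have := MeasurableSpace.measurableSet_generateFrom (Set.mem_singleton (E i))
    split_ifs
    exacts [this, this.compl]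

open Classical in
lemma measureReal_eventConfig [Fintype ι] [DecidableEq ι] [IsProbabilityMeasure μ]
    (hE : ∀ i, MeasurableSet (E i)) (h : iIndepSet E μ) (Q : (ι → Bool) → Prop) :
    μ.real {ω | Q (eventConfig E ω)} =
      ∑ x, (if Q x then 1 else 0) * bernoulliWeight (fun i => μ.real (E i)) x := by
  have hset : {ω | Q (eventConfig E ω)} =
      ⋃ x ∈ Finset.univ.filter Q, {ω | eventConfig E ω = x} := by
    ext ω; simp
  rw [hset, measureReal_biUnion_finset]
  · simp only [ite_mul, one_mul, zero_mul, ← Finset.sum_filter,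
      measureReal_eventConfig_eq hE h]
  · intro x _ y _ hxy
    exact Set.disjoint_left.2 fun ω h₁ h₂ => hxy (h₁.symm.trans h₂)
  · exact fun x _ => measurableSet_eventConfig_eq hE x

end Configuration

section Connector

variable {V : Type*} [Fintype V] [DecidableEq V] {A : Finset V}

open Classical in
/-- The probability that `u` is a connector when the edges are independent with
probabilities `r`. -/
noncomputable def connectorProb (A : Finset V) (r : Sym2 V → ℝ) (u : V) : ℝ :=
  ∑ x, (if IsConnector A x u then 1 else 0) * bernoulliWeight r x

/-- A node whose edges are all at least as likely as those of `v` is at least as likely to be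
a connector. -/
lemma connectorProb_le_of_edge_le {r : Sym2 V → ℝ} (hr0 : ∀ s, 0 ≤ r s) (hr1 : ∀ s, r s ≤ 1)
    {o v : V} (ho : o ∈ A) (hv : v ∈ A) (hdiag : r s(o, o) = r s(v, v))
    (hle : ∀ w, w ≠ o → w ≠ v → r s(v, w) ≤ r s(o, w)) :
    connectorProb A r v ≤ connectorProb A r o := by
  classical
  by_cases hov : o = v
  · rw [hov]
  let π := Equiv.swap o v
  have hππ : ∀ s : Sym2 V, Sym2.map π (Sym2.map π s) = s := fun s => by
    induction s with | _ a b => simp [π]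
  let τ : Sym2 V ≃ Sym2 V := ⟨Sym2.map π, Sym2.map π, hππ, hππ⟩
  have hπw : ∀ w, w ≠ o → w ≠ v → π w = w := fun w h₁ h₂ => Equiv.swap_apply_of_ne_of_ne h₁ h₂
  have hsymm : connectorProb A r v =
      ∑ x, (if IsConnector A x o then (1 : ℝ) else 0) * bernoulliWeight (r ∘ τ) x := by
    rw [sum_bernoulliWeight_comp_equiv, connectorProb]
    refine Finset.sum_congr rfl fun x _ => ?_
    have : IsConnector A (x ∘ τ) o ↔ IsConnector A x v := by
      have h := isConnector_comp_map π (swap_mem_iff ho hv) x o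
      rwa [Equiv.swap_apply_left] at h
    simp only [this]
  rw [hsymm, connectorProb]
  refine sum_bernoulliWeight_le_of_exchange (a := fun w => s(o, w)) (b := fun w => s(v, w))
    (fun w w' h => Sym2.congr_right.1 h) (fun w w' h => Sym2.congr_right.1 h)
    (Finset.univ.filter fun w => w ≠ o ∧ w ≠ v) ?_ ?_ hr0 hr1 ?_ ?_ ?_ ?_
  · intro w hw w' hw'
    simp only [Finset.mem_filter, Finset.mem_univ, true_and] at hw hw'
    simp
    grind
  · intro w hw x hxo hxv
    simp only [Finset.mem_filter, Finset.mem_univ, true_and] at hw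
    by_cases hc : IsConnector A (x ∘ Equiv.swap s(o, w) s(v, w)) o
    · rw [if_pos hc, if_pos (hc.of_swap ho hv hw.1 hw.2 hxo hxv)]
    · rw [if_neg hc]; split_ifs <;> simp
  · intro w hw
    simp only [Finset.mem_filter, Finset.mem_univ, true_and] at hw
    exact hle w hw.1 hw.2
  · intro w hw
    simp only [Finset.mem_filter, Finset.mem_univ, true_and] at hw
    simp [τ, hπw w hw.1 hw.2, π]
  · intro w hw
    simp only [Finset.mem_filter, Finset.mem_univ, true_and] at hw
    simp [τ, hπw w hw.1 hw.2, π]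
  · intro s hs
    simp only [Finset.mem_filter, Finset.mem_univ, true_and] at hs
    change r (Sym2.map π s) = r s
    induction s with | _ a b =>
    by_cases hao : a = o
    · by_cases hbo : b = o
      · simp [π, hao, hbo, hdiag]
      · by_cases hbv : b = v
        · simp [π, hao, hbv, Sym2.eq_swap]
        · exact absurd (by rw [hao]) (hs b ⟨hbo, hbv⟩).1
    by_cases hav : a = v
    · by_cases hbv : b = v
      · simp [π, hav, hbv, hdiag]
      · by_cases hbo : b = o
        · simp [π, hav, hbo, Sym2.eq_swap]
        · exact absurd (by rw [hav]) (hs b ⟨hbo, hbv⟩).2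
    by_cases hbo : b = o
    · exact absurd (by rw [hbo, Sym2.eq_swap]) (hs a ⟨hao, hav⟩).1
    by_cases hbv : b = v
    · exact absurd (by rw [hbv, Sym2.eq_swap]) (hs a ⟨hao, hav⟩).2
    simp [hπw a hao hav, hπw b hbo hbv]

lemma one_lt_sum_connectorProb {r : Sym2 V → ℝ} (hr0 : ∀ s, 0 ≤ r s) (hr1 : ∀ s, r s ≤ 1)
    (hpos : ∀ u ∈ A, ∀ v ∈ A, u ≠ v → 0 < r s(u, v)) (hA : 2 ≤ A.card) :
    1 < ∑ u ∈ A, connectorProb A r u := by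
  classical
  have hne : A.Nonempty := Finset.card_pos.1 (by omega)
  have hsum : ∑ u ∈ A, connectorProb A r u =
      ∑ x, ((A.filter (IsConnector A x)).card : ℝ) * bernoulliWeight r x := by
    simp only [connectorProb]
    rw [Finset.sum_comm]
    refine Finset.sum_congr rfl fun x _ => ?_
    rw [← Finset.sum_mul, Finset.sum_boole]
  rw [hsum, ← sum_bernoulliWeight r]
  have hcard : ∀ x, 1 ≤ (A.filter (IsConnector A x)).card := fun x => by
    obtain ⟨u, hu, hmax⟩ := A.exists_max_image (internalDegree A x) hne
    exact Finset.card_pos.2 ⟨u, Finset.mem_filter.2 ⟨hu, hmax⟩⟩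
  let x₀ : Sym2 V → Bool := fun s => decide (0 < r s)
  have hdeg : ∀ u ∈ A, internalDegree A x₀ u = A.card - 1 := fun u hu => by
    rw [← Finset.card_erase_of_mem hu, internalDegree]
    congr 1
    ext t
    simp only [Finset.mem_filter, Finset.mem_erase, x₀, decide_eq_true_eq]
    exact ⟨fun h => ⟨h.2.1, h.1⟩, fun h => ⟨h.2, h.1, hpos u hu t h.2 h.1.symm⟩⟩
  have hall : A.filter (IsConnector A x₀) = A :=
    Finset.filter_true_of_mem fun u hu t ht => by rw [hdeg u hu, hdeg t ht]
  have hW₀ : 0 < bernoulliWeight r x₀ := by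
    refine Finset.prod_pos fun s _ => ?_
    by_cases hs : 0 < r s
    · simp [x₀, hs]
    · simp only [x₀, hs, decide_false, Bool.false_eq_true, if_false]
      linarith
  refine Finset.sum_lt_sum (fun x _ => ?_) ⟨x₀, Finset.mem_univ _, ?_⟩
  · exact le_mul_of_one_le_left (bernoulliWeight_nonneg hr0 hr1 x) (by exact_mod_cast hcard x)
  · rw [hall]
    exact lt_mul_of_one_lt_left hW₀ (by exact_mod_cast hA)

end Connector

/-- Key step in the proof of Observation 3 (AGM): with communities `A ⊇ O` (the overlap),
independent events `E s` over unordered pairs `s` of distinct elements of `A`, occurring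
with probability `1 - (1-p_A)(1-p_B)` for pairs inside `O` and `p_A` otherwise, any fixed
node `o ∈ O` attains the maximal internal degree of `A` with probability strictly greater
than `1 / |A|`. -/
theorem fixed_overlap_node_is_connector {V : Type*} [Fintype V] [DecidableEq V]
    {Ω : Type*} [MeasureSpace Ω] [IsProbabilityMeasure (ℙ : Measure Ω)]
    (A O : Finset V) (hOA : O ⊆ A) (hA : 3 ≤ A.card)
    (hO : 2 ≤ O.card) (hOlt : O.card < A.card)
    (pA pB : ℝ) (hpA0 : 0 < pA) (hpA1 : pA < 1) (hpB0 : 0 < pB) (hpB1 : pB ≤ 1)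
    (E : Sym2 V → Set Ω)
    (hmeas : ∀ s : Sym2 V, MeasurableSet (E s))
    (hindep : iIndepSet
      (fun s : {s : Sym2 V // ¬ s.IsDiag ∧ ∀ v ∈ s, v ∈ A} => E s.1) ℙ)
    (hprobO : ∀ u v : V, u ≠ v → u ∈ O → v ∈ O →
      ((ℙ : Measure Ω) (E s(u, v))).toReal = 1 - (1 - pA) * (1 - pB))
    (hprobA : ∀ u v : V, u ≠ v → u ∈ A → v ∈ A → ¬(u ∈ O ∧ v ∈ O) →
      ((ℙ : Measure Ω) (E s(u, v))).toReal = pA)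
    (d : V → Ω → ℕ)
    (hd : ∀ u ω, d u ω = Set.ncard {v : V | v ∈ A ∧ v ≠ u ∧ ω ∈ E s(u, v)})
    (o : V) (ho : o ∈ O) :
    ((ℙ : Measure Ω)
        {ω | d o ω = A.sup (fun u => d u ω)}).toReal
      > 1 / (A.card : ℝ) := by
  classical
  let p : Sym2 V → Prop := fun s => ¬ s.IsDiag ∧ ∀ v ∈ s, v ∈ A
  let E' : Sym2 V → Set Ω := fun s => if p s then E s else ∅
  have hE' : ∀ s, MeasurableSet (E' s) := fun s => by
    simp only [E']
    split_ifs
    exacts [hmeas s, MeasurableSet.empty]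
  have hindep' : iIndepSet E' ℙ := iIndepSet_ite_empty (p := p) hmeas hindep
  let r : Sym2 V → ℝ := fun s => (ℙ : Measure Ω).real (E' s)
  have hr0 : ∀ s, 0 ≤ r s := fun s => measureReal_nonneg
  have hr1 : ∀ s, r s ≤ 1 := fun s => measureReal_le_one
  have hp : ∀ u v, p s(u, v) ↔ u ≠ v ∧ u ∈ A ∧ v ∈ A := fun u v => by simp [p]
  have hrout : ∀ u v, ¬ (u ≠ v ∧ u ∈ A ∧ v ∈ A) → r s(u, v) = 0 := fun u v h => by
    simp [r, E', hp, h]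
  have hrin : ∀ u v, u ≠ v → u ∈ A → v ∈ A →
      r s(u, v) = ((ℙ : Measure Ω) (E s(u, v))).toReal := fun u v h hu hv => by
    simp only [r, E', if_pos ((hp u v).2 ⟨h, hu, hv⟩), measureReal_def]
  have hge : ∀ u v, u ≠ v → u ∈ A → v ∈ A → pA ≤ r s(u, v) := fun u v h hu hv => by
    rw [hrin u v h hu hv]
    by_cases hO' : u ∈ O ∧ v ∈ O
    · rw [hprobO u v h hO'.1 hO'.2]; nlinarith
    · rw [hprobA u v h hu hv hO']
  have hmono : ∀ v ∈ A, ∀ w, w ≠ o → w ≠ v → r s(v, w) ≤ r s(o, w) := fun v hv w hwo hwv => by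
    by_cases hw : w ∈ A
    · by_cases hO' : v ∈ O ∧ w ∈ O
      · rw [hrin v w hwv.symm hv hw, hrin o w hwo.symm (hOA ho) hw,
          hprobO v w hwv.symm hO'.1 hO'.2, hprobO o w hwo.symm ho hO'.2]
      · rw [hrin v w hwv.symm hv hw, hprobA v w hwv.symm hv hw hO']
        exact hge o w hwo.symm (hOA ho) hw
    · rw [hrout v w (by tauto), hrout o w (by tauto)]
  have hle : ∀ v ∈ A, connectorProb A r v ≤ connectorProb A r o := fun v hv =>
    connectorProb_le_of_edge_le hr0 hr1 (hOA ho) hv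
      (by rw [hrout o o (by simp), hrout v v (by simp)]) (hmono v hv)
  have hone : 1 < ∑ u ∈ A, connectorProb A r u :=
    one_lt_sum_connectorProb hr0 hr1
      (fun u hu v hv h => hpA0.trans_le (hge u v h hu hv)) (by omega)
  have hdeg : ∀ u ∈ A, ∀ ω, d u ω = internalDegree A (eventConfig E' ω) u := fun u hu ω => by
    rw [hd, internalDegree, ← Set.ncard_coe_finset]
    congr 1
    ext v
    simp only [Set.mem_ofPred_eq, Finset.coe_filter, eventConfig, decide_eq_true_eq, E']
    refine and_congr_right fun hv => and_congr_right fun hvu => ?_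
    rw [if_pos ((hp u v).2 ⟨hvu.symm, hu, hv⟩)]
  have hset : {ω | d o ω = A.sup fun u => d u ω} =
      {ω | IsConnector A (eventConfig E' ω) o} := by
    ext ω
    simp only [Set.mem_ofPred_eq, IsConnector]
    constructor
    · intro h t ht
      rw [← hdeg t ht, ← hdeg o (hOA ho), h]
      exact Finset.le_sup (f := fun u => d u ω) ht
    · intro h
      refine le_antisymm (Finset.le_sup (f := fun u => d u ω) (hOA ho))
        (Finset.sup_le fun t ht => ?_)
      rw [hdeg t ht, hdeg o (hOA ho)]
      exact h t ht
  have hprob : ((ℙ : Measure Ω) {ω | d o ω = A.sup fun u => d u ω}).toReal =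
      connectorProb A r o := by
    rw [hset, ← measureReal_def, measureReal_eventConfig hE' hindep' (IsConnector A · o),
      connectorProb]
  have hcard : (0 : ℝ) < A.card := by exact_mod_cast (by omega : 0 < A.card)
  rw [hprob, gt_iff_lt, div_lt_iff₀ hcard]
  calc (1 : ℝ) < ∑ u ∈ A, connectorProb A r u := hone
    _ ≤ A.card • connectorProb A r o := Finset.sum_le_card_nsmul _ _ _ hle
    _ = connectorProb A r o * A.card := by rw [nsmul_eq_mul, mul_comm]
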